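/- Let v_1, ..., v_r, v_{r+1}, ..., v_q ∈ Z^n and w_1, ..., w_q ∈ Z, and let x_0 ∈ Z^n satisfy ⟨x_0, v_i⟩ = w_i for i ≤ r and ⟨x_0, v_i⟩ < w_i for i > r. If {(v_1,w_1), ..., (v_q,w_q)} ⊂ Z^{n+1} is a Hilbert basis, then {v_1, ..., v_r} ⊂ Z^n is a Hilbert basis. -/

import Mathlib

open Finset

/-- Membership in the real cone generated by a finite family of integral vectors. -/
def coneMem {n : ℕ} {ι : Type} [Fintype ι] (v : ι → Fin n → ℤ) (x : Fin n → ℤ) : Prop :=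
  ∃ c : ι → ℝ, (∀ i, 0 ≤ c i) ∧
    (fun j => (x j : ℝ)) = ∑ i, c i • (fun j => (v i j : ℝ))

/-- A finite family of integral vectors is a Hilbert basis if every integral vector
in the real cone it generates is a non-negative integer combination of the family. -/
def IsHilbertBasis {n : ℕ} {ι : Type} [Fintype ι] (v : ι → Fin n → ℤ) : Prop :=
  ∀ x : Fin n → ℤ, coneMem v x → ∃ c : ι → ℕ, x = ∑ i, c i • v i

theorem Fin.sum_castLE_of_eq_zero {M : Type*} [AddCommMonoid M] {r q : ℕ} (hr : r ≤ q)
    (f : Fin q → M) (hf : ∀ i : Fin q, r ≤ (i : ℕ) → f i = 0) :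
    ∑ i : Fin r, f (Fin.castLE hr i) = ∑ i, f i := by
  obtain ⟨s, rfl⟩ := Nat.exists_eq_add_of_le hr
  rw [Fin.sum_univ_add, Finset.sum_eq_zero (s := univ) (f := fun i => f (Fin.natAdd r i))
    (fun i _ => hf _ (by simp)), add_zero]
  rfl

/-- If `x₀ ∈ ℤⁿ` satisfies `⟨x₀,vᵢ⟩ = wᵢ` for `i ≤ r` and
`⟨x₀,vᵢ⟩ < wᵢ` for `i > r`, and `{(vᵢ,wᵢ)}ᵢ₌₁^q` is a Hilbert basis, then
`{v₁,…,v_r}` is a Hilbert basis. -/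
theorem stmt11 (n q r : ℕ) (hr : r ≤ q)
    (v : Fin q → Fin n → ℤ) (w : Fin q → ℤ) (x0 : Fin n → ℤ)
    (heq : ∀ i : Fin q, (i : ℕ) < r → ∑ j, x0 j * v i j = w i)
    (hlt : ∀ i : Fin q, r ≤ (i : ℕ) → ∑ j, x0 j * v i j < w i)
    (hHilb : IsHilbertBasis (fun i => Fin.snoc (v i) (w i))) :
    IsHilbertBasis (fun i : Fin r => v (Fin.castLE hr i)) := by
  rintro x ⟨c, hc, hx⟩
  have hxj (j : Fin n) : (x j : ℝ) = ∑ i, c i * (v (Fin.castLE hr i) j : ℝ) := by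
    simpa using congrFun hx j
  let d : Fin q → ℝ := fun i => if h : (i : ℕ) < r then c ⟨i, h⟩ else 0
  have hd_lt (i : Fin r) : d (Fin.castLE hr i) = c i := by simp [d]
  have hd_ge (i : Fin q) (hi : r ≤ (i : ℕ)) : d i = 0 := by simp [d, hi]
  have hd_nonneg (i : Fin q) : 0 ≤ d i := by
    by_cases h : (i : ℕ) < r
    · simpa [d, h] using hc _
    · simp [d, h]
  have hxd (j : Fin n) : (x j : ℝ) = ∑ i, d i * (v i j : ℝ) := by
    rw [hxj, ← Fin.sum_castLE_of_eq_zero hr _ (fun i hi => by simp [hd_ge i hi])]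
    simp [hd_lt]
  obtain ⟨k, hk⟩ := hHilb (Fin.snoc x (∑ j, x0 j * x j)) ⟨d, hd_nonneg, by
    funext j
    refine Fin.lastCases ?_ (fun j => ?_) j
    · have hdw (i : Fin q) : d i * (w i : ℝ) = d i * ∑ j, (x0 j : ℝ) * v i j := by
        by_cases h : (i : ℕ) < r
        · rw [← heq i h]
          push_cast
          rfl
        · simp [hd_ge i (not_lt.mp h)]
      simp only [Fin.snoc_last, Finset.sum_apply, Pi.smul_apply, smul_eq_mul, hdw]
      push_cast
      simp only [hxd, Finset.mul_sum]
      rw [Finset.sum_comm]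
      exact Finset.sum_congr rfl fun i _ => Finset.sum_congr rfl fun j _ => by ring
    · simpa using hxd j⟩
  have hkx (j : Fin n) : x j = ∑ i, (k i : ℤ) * v i j := by
    simpa using congrFun hk j.castSucc
  have hkw : ∑ j, x0 j * x j = ∑ i, (k i : ℤ) * w i := by
    simpa using congrFun hk (Fin.last n)
  have hle (i : Fin q) : ∑ j, x0 j * v i j ≤ w i := by
    by_cases h : (i : ℕ) < r
    · exact (heq i h).le
    · exact (hlt i (not_lt.mp h)).le
  have hsum : ∑ i, (k i : ℤ) * (w i - ∑ j, x0 j * v i j) = 0 := by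
    simp only [mul_sub, Finset.sum_sub_distrib]
    rw [← hkw, sub_eq_zero]
    simp only [hkx, Finset.mul_sum]
    rw [Finset.sum_comm]
    exact Finset.sum_congr rfl fun i _ => Finset.sum_congr rfl fun j _ => by ring
  have hk_ge (i : Fin q) (hi : r ≤ (i : ℕ)) : k i = 0 := by
    have h := (Finset.sum_eq_zero_iff_of_nonneg fun i _ =>
      mul_nonneg (Int.natCast_nonneg (k i)) (sub_nonneg.mpr (hle i))).mp hsum i (mem_univ i)
    exact_mod_cast (mul_eq_zero.mp h).resolve_right (sub_pos.mpr (hlt i hi)).ne'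
  refine ⟨fun i => k (Fin.castLE hr i), ?_⟩
  rw [Fin.sum_castLE_of_eq_zero hr (fun i => k i • v i) (fun i hi => by simp [hk_ge i hi])]
  funext j
  simpa using hkx j
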